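/- Let G be the sibling tree ST_n with n ≥ 1. Then the locating-domination number of G is γ^L(G) = (2^{n+2}+1)/5 if n ≡ 0 (mod 4), γ^L(G) = (2^{n+2}+2)/5 if n ≡ 1 (mod 4), γ^L(G) = (2^{n+2}-1)/5 if n ≡ 2 (mod 4), and γ^L(G) = (2^{n+2}-2)/5 if n ≡ 3 (mod 4). -/

import Mathlib

/-- Vertex labels of a level-`n` complete binary tree: `1, …, 2^(n+1) - 1`. -/
def treeVerts (n : ℕ) : Finset ℕ := Finset.Icc 1 (2 ^ (n + 1) - 1)

/-- The hypertree `HT(n)`: each vertex `x` is adjacent to its children `2x` and `2x+1`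
(when the labels lie in the vertex set), and two vertices at the same level `i`
(`1 ≤ i ≤ n`, i.e. `2^i ≤ x < 2^(i+1)`) are adjacent iff their labels differ by `2^(i-1)`. -/
def hyperTree (n : ℕ) : SimpleGraph ℕ :=
  SimpleGraph.fromRel (fun x y =>
    x ∈ treeVerts n ∧ y ∈ treeVerts n ∧
      (y = 2 * x ∨ y = 2 * x + 1 ∨
        ∃ i, 1 ≤ i ∧ i ≤ n ∧ 2 ^ i ≤ x ∧ x < 2 ^ (i + 1) ∧ 2 ^ i ≤ y ∧ y < 2 ^ (i + 1) ∧
          y = x + 2 ^ (i - 1)))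

/-- The root-fault hypertree `HT*(n)`: the induced subgraph of `HT(n)` obtained by
deleting the root vertex `1`. -/
def rootFaultHyperTree (n : ℕ) : SimpleGraph ℕ :=
  SimpleGraph.fromRel (fun x y => x ≠ 1 ∧ y ≠ 1 ∧ (hyperTree n).Adj x y)

/-- Vertex labels of the root-fault hypertree `HT*(n)`: `2, …, 2^(n+1) - 1`. -/
def rootFaultVerts (n : ℕ) : Finset ℕ := Finset.Icc 2 (2 ^ (n + 1) - 1)

/-- The sibling tree `ST_n`: each vertex `x` is adjacent to its children `2x` and `2x+1`
(when the labels lie in the vertex set), and the two children `2p`, `2p+1` of a common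
parent are adjacent. -/
def siblingTree (n : ℕ) : SimpleGraph ℕ :=
  SimpleGraph.fromRel (fun x y =>
    x ∈ treeVerts n ∧ y ∈ treeVerts n ∧
      (y = 2 * x ∨ y = 2 * x + 1 ∨ ∃ p, x = 2 * p ∧ y = 2 * p + 1))

/-- `S` is a dominating set of the graph `G` with (finite) vertex set `V`:
every vertex of `V` not in `S` is adjacent to some vertex of `S`. -/
def IsDomSetOn (G : SimpleGraph ℕ) (V S : Finset ℕ) : Prop :=
  S ⊆ V ∧ ∀ v ∈ V, v ∉ S → ∃ u ∈ S, G.Adj u v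

/-- `S` is a total dominating set of the graph `G` with (finite) vertex set `V`:
every vertex of `V` is adjacent to some vertex of `S`. -/
def IsTotalDomSetOn (G : SimpleGraph ℕ) (V S : Finset ℕ) : Prop :=
  S ⊆ V ∧ ∀ v ∈ V, ∃ u ∈ S, G.Adj u v

/-- `S` locates the vertices of `V` outside `S`: any two distinct vertices `u, v` of `V`
outside `S` satisfy `N(u) ∩ S ≠ N(v) ∩ S`. -/
def LocatesOn (G : SimpleGraph ℕ) (V S : Finset ℕ) : Prop :=
  ∀ u ∈ V, ∀ v ∈ V, u ∉ S → v ∉ S → u ≠ v →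
    ({w : ℕ | w ∈ S ∧ G.Adj w u} ≠ {w : ℕ | w ∈ S ∧ G.Adj w v})

/-- `S` is a locating-dominating set of `G` with vertex set `V`. -/
def IsLocDomSetOn (G : SimpleGraph ℕ) (V S : Finset ℕ) : Prop :=
  IsDomSetOn G V S ∧ LocatesOn G V S

/-- `S` is a locating-total dominating set of `G` with vertex set `V`. -/
def IsLocTotalDomSetOn (G : SimpleGraph ℕ) (V S : Finset ℕ) : Prop :=
  IsTotalDomSetOn G V S ∧ LocatesOn G V S

/-- The domination number `γ` of the graph `G` with vertex set `V`. -/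
noncomputable def domNum (G : SimpleGraph ℕ) (V : Finset ℕ) : ℕ :=
  sInf {k | ∃ S : Finset ℕ, IsDomSetOn G V S ∧ S.card = k}

/-- The total domination number `γ_t` of the graph `G` with vertex set `V`. -/
noncomputable def totalDomNum (G : SimpleGraph ℕ) (V : Finset ℕ) : ℕ :=
  sInf {k | ∃ S : Finset ℕ, IsTotalDomSetOn G V S ∧ S.card = k}

/-- The locating-domination number `γ^L` of the graph `G` with vertex set `V`. -/
noncomputable def locDomNum (G : SimpleGraph ℕ) (V : Finset ℕ) : ℕ :=
  sInf {k | ∃ S : Finset ℕ, IsLocDomSetOn G V S ∧ S.card = k}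

/-- The locating-total domination number `γ^L_t` of the graph `G` with vertex set `V`. -/
noncomputable def locTotalDomNum (G : SimpleGraph ℕ) (V : Finset ℕ) : ℕ :=
  sInf {k | ∃ S : Finset ℕ, IsLocTotalDomSetOn G V S ∧ S.card = k}

/-- Adjacency in the infinite sibling tree, as a predicate that linear arithmetic can decide. -/
def SibNbr (w y : ℕ) : Prop :=
  w = y / 2 ∨ (w ≠ y ∧ w / 2 = y / 2) ∨ w = 2 * y ∨ w = 2 * y + 1

theorem mem_treeVerts {n x : ℕ} : x ∈ treeVerts n ↔ 1 ≤ x ∧ x < 2 ^ (n + 1) := by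
  have : 0 < 2 ^ (n + 1) := by positivity
  simp only [treeVerts, Finset.mem_Icc]
  omega

theorem siblingTree_adj {n x y : ℕ} :
    (siblingTree n).Adj x y ↔ x ∈ treeVerts n ∧ y ∈ treeVerts n ∧ SibNbr x y := by
  simp only [siblingTree, SimpleGraph.fromRel_adj, mem_treeVerts, SibNbr]
  constructor
  · rintro ⟨hne, ⟨hx, hy, h | h | ⟨p, h, h'⟩⟩ | ⟨hx, hy, h | h | ⟨p, h, h'⟩⟩⟩ <;> omega
  · rintro ⟨hx, hy, h | ⟨hne, h⟩ | h | h⟩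
    · refine ⟨by omega, Or.inl ⟨hx, hy, by omega⟩⟩
    · refine ⟨hne, ?_⟩
      rcases Nat.lt_or_gt_of_ne hne with h' | h'
      · exact Or.inl ⟨hx, hy, Or.inr (Or.inr ⟨x / 2, by omega, by omega⟩)⟩
      · exact Or.inr ⟨hy, hx, Or.inr (Or.inr ⟨x / 2, by omega, by omega⟩)⟩
    · exact ⟨by omega, Or.inr ⟨hy, hx, by omega⟩⟩
    · exact ⟨by omega, Or.inr ⟨hy, hx, by omega⟩⟩

theorem isLocDomSetOn_siblingTree_iff {n : ℕ} {S : Finset ℕ} :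
    IsLocDomSetOn (siblingTree n) (treeVerts n) S ↔
      (∀ x ∈ S, 1 ≤ x ∧ x < 2 ^ (n + 1)) ∧
      (∀ v, 1 ≤ v → v < 2 ^ (n + 1) → v ∉ S → ∃ u ∈ S, SibNbr u v) ∧
      (∀ u v, 1 ≤ u → u < 2 ^ (n + 1) → 1 ≤ v → v < 2 ^ (n + 1) → u ∉ S → v ∉ S →
        (∀ w ∈ S, SibNbr w u ↔ SibNbr w v) → u = v) := by
  simp only [IsLocDomSetOn, IsDomSetOn, LocatesOn, siblingTree_adj, mem_treeVerts,
    Finset.subset_iff, ne_eq, Set.ext_iff, Set.mem_ofPred_eq]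
  constructor
  · rintro ⟨⟨hS, hdom⟩, hloc⟩
    refine ⟨fun x hx => hS hx, fun v h1 h2 hv => ?_, fun u v hu hu' hv hv' huS hvS h => ?_⟩
    · obtain ⟨u, hu, -, -, h⟩ := hdom v ⟨h1, h2⟩ hv
      exact ⟨u, hu, h⟩
    · by_contra hne
      refine hloc u ⟨hu, hu'⟩ v ⟨hv, hv'⟩ huS hvS hne fun w => ?_
      have := h w
      tauto
  · rintro ⟨hS, hdom, hloc⟩
    refine ⟨⟨hS, fun v hv hvS => ?_⟩, fun u hu v hv huS hvS hne h => ?_⟩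
    · obtain ⟨u, hu, h⟩ := hdom v hv.1 hv.2 hvS
      exact ⟨u, hu, hS hu, hv, h⟩
    · refine hne (hloc u v hu.1 hu.2 hv.1 hv.2 huS hvS fun w hw => ?_)
      simpa [hw, hS hw, hu, hv] using h w

/-! ### An optimal locating-dominating set -/

/-- The vertices at height `2` modulo `4`, the even vertices at height `0` modulo `4`, and the
root if its height is `0` or `1` modulo `4`. -/
def sibOptSet (n : ℕ) : Finset ℕ :=
  (treeVerts n).filter fun x =>
    (n + 3 * Nat.log 2 x) % 4 = 2 ∨ ((n + 3 * Nat.log 2 x) % 4 = 0 ∧ x % 2 = 0) ∨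
      (x = 1 ∧ n % 4 ≤ 1)

theorem mem_sibOptSet {n x : ℕ} :
    x ∈ sibOptSet n ↔ (1 ≤ x ∧ x < 2 ^ (n + 1)) ∧
      ((n + 3 * Nat.log 2 x) % 4 = 2 ∨ ((n + 3 * Nat.log 2 x) % 4 = 0 ∧ x % 2 = 0) ∨
        (x = 1 ∧ n % 4 ≤ 1)) := by
  rw [sibOptSet, Finset.mem_filter, mem_treeVerts]

theorem two_mul_add_one_lt_of_log_lt {n x : ℕ} (h : Nat.log 2 x < n) :
    2 * x + 1 < 2 ^ (n + 1) := by
  have := Nat.lt_pow_of_log_lt (by norm_num) h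
  rw [pow_succ]
  omega

theorem log_two_mul {x : ℕ} (hx : 1 ≤ x) : Nat.log 2 (2 * x) = Nat.log 2 x + 1 := by
  rw [mul_comm, Nat.log_mul_base (by norm_num) (by omega)]

theorem log_div_two_succ {x : ℕ} (hx : 2 ≤ x) : Nat.log 2 (x / 2) + 1 = Nat.log 2 x :=
  (Nat.log_of_one_lt_of_le (by norm_num) hx).symm

theorem log_two_mul_add_one {x : ℕ} (hx : 1 ≤ x) :
    Nat.log 2 (2 * x + 1) = Nat.log 2 x + 1 := by
  rw [← log_div_two_succ (by omega)]
  congr 2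
  omega

theorem sibOptSet_code {n u : ℕ} (h1 : 1 ≤ u) (h2 : u < 2 ^ (n + 1)) (hu : u ∉ sibOptSet n) :
    (u % 2 = 1 ∧ 2 ≤ u ∧ u - 1 ∈ sibOptSet n) ∨
    (2 ≤ u ∧ 2 * u ∈ sibOptSet n ∧ u / 2 ∈ sibOptSet n) ∨
    (2 * u ∈ sibOptSet n ∧ 2 * u + 1 ∈ sibOptSet n) := by
  have hlog : Nat.log 2 u < n + 1 := Nat.log_lt_of_lt_pow (by omega) h2
  have hl := two_mul_add_one_lt_of_log_lt (n := n) (x := u)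
  have h2u := log_two_mul h1
  have h2u1 := log_two_mul_add_one h1
  have hroot : u = 1 → Nat.log 2 u = 0 := by rintro rfl; simp
  simp only [mem_sibOptSet, h2u, h2u1] at hu ⊢
  have hhalf := log_div_two_succ (x := u)
  have hpred : u % 2 = 1 → 2 ≤ u → Nat.log 2 (u - 1) = Nat.log 2 u := fun h h' => by
    rw [← log_div_two_succ (x := u - 1) (by omega), ← hhalf h']
    congr 2
    omega
  generalize Nat.log 2 u = k at *
  generalize Nat.log 2 (u / 2) = k' at *
  generalize Nat.log 2 (u - 1) = k'' at *
  generalize 2 ^ (n + 1) = M at *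
  have hmod : (n + 3 * k) % 4 < 4 := Nat.mod_lt _ (by norm_num)
  rcases (by omega : (n + 3 * k) % 4 = 0 ∨ (n + 3 * k) % 4 = 1 ∨ (n + 3 * k) % 4 = 2 ∨
    (n + 3 * k) % 4 = 3) with e | e | e | e
  · have hodd : u % 2 = 1 := by omega
    have h2 : 2 ≤ u := by
      by_contra h
      have hu1 : u = 1 := by omega
      have := hroot hu1
      subst this
      exact hu ⟨⟨h1, by omega⟩, Or.inr (Or.inr ⟨hu1, by omega⟩)⟩
    have hk'' := hpred hodd h2
    subst hk''
    exact Or.inl ⟨hodd, h2, ⟨by omega, by omega⟩, Or.inr (Or.inl ⟨e, by omega⟩)⟩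
  · have h2 : 2 ≤ u := by
      by_contra h
      have hu1 : u = 1 := by omega
      have := hroot hu1
      subst this
      exact hu ⟨⟨h1, by omega⟩, Or.inr (Or.inr ⟨hu1, by omega⟩)⟩
    have hk' := hhalf h2
    have hM := hl (by omega)
    exact Or.inr (Or.inl ⟨h2, ⟨⟨by omega, by omega⟩, Or.inr (Or.inl ⟨by omega, by omega⟩)⟩,
      ⟨by omega, by omega⟩, Or.inl (by omega)⟩)
  · exact absurd ⟨⟨h1, by omega⟩, Or.inl e⟩ hu
  · have hM := hl (by omega)
    exact Or.inr (Or.inr ⟨⟨⟨by omega, by omega⟩, Or.inl (by omega)⟩,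
      ⟨by omega, by omega⟩, Or.inl (by omega)⟩)

theorem isLocDomSetOn_sibOptSet (n : ℕ) :
    IsLocDomSetOn (siblingTree n) (treeVerts n) (sibOptSet n) := by
  refine isLocDomSetOn_siblingTree_iff.2 ⟨fun x hx => (mem_sibOptSet.1 hx).1,
    fun v h1 h2 hv => ?_, fun u v hu hu' hv hv' huS hvS h => ?_⟩
  · rcases sibOptSet_code h1 h2 hv with ⟨a, b, c⟩ | ⟨a, b, c⟩ | ⟨a, b⟩
    · exact ⟨_, c, by unfold SibNbr; omega⟩
    · exact ⟨_, c, by unfold SibNbr; omega⟩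
    · exact ⟨_, a, by unfold SibNbr; omega⟩
  · unfold SibNbr at h
    rcases sibOptSet_code hu hu' huS with ⟨a, b, c⟩ | ⟨a, b, c⟩ | ⟨a, b⟩
    · rcases sibOptSet_code hv hv' hvS with ⟨a', b', c'⟩ | ⟨a', b', c'⟩ | ⟨a', b'⟩
      · have := h _ c
        have := h _ c'
        omega
      · have := h _ b'
        have := h _ c'
        omega
      · have := h _ a'
        have := h _ b'
        omega
    · have := h _ b
      have := h _ c
      omega
    · have := h _ a
      have := h _ b
      omega

theorem card_sibOptSet_add_four_le (n : ℕ) :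
    (sibOptSet (n + 4)).card ≤ (sibOptSet n).card + 12 * 2 ^ n := by
  have hsub : sibOptSet (n + 4) ⊆ sibOptSet n ∪
      ((Finset.Ico (2 ^ (n + 3)) (2 ^ (n + 4))).image (2 * ·) ∪
        Finset.Ico (2 ^ (n + 2)) (2 ^ (n + 3))) := by
    intro x hx
    rw [mem_sibOptSet] at hx
    simp only [Finset.mem_union, Finset.mem_image, Finset.mem_Ico, mem_sibOptSet]
    obtain ⟨⟨h1, h2⟩, h⟩ := hx
    have hx0 : x ≠ 0 := by omega
    have hle := Nat.pow_log_le_self 2 hx0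
    have hlt := Nat.lt_pow_succ_log_self (b := 2) (by norm_num) x
    have hk : Nat.log 2 x < n + 5 := Nat.log_lt_of_lt_pow hx0 h2
    have hroot : x = 1 → Nat.log 2 x = 0 := by rintro rfl; simp
    by_cases hkn : Nat.log 2 x ≤ n
    · left
      have : x < 2 ^ (n + 1) := Nat.lt_pow_of_log_lt (by norm_num) (by omega)
      omega
    · right
      rcases (by omega : Nat.log 2 x = n + 4 ∧ x % 2 = 0 ∨ Nat.log 2 x = n + 2) with ⟨e, he⟩ | e
      · left
        rw [e] at hle hlt
        refine ⟨x / 2, ?_, by omega⟩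
        simp only [pow_succ] at hle hlt ⊢
        omega
      · right
        rw [e] at hle hlt
        exact ⟨hle, hlt⟩
  refine (Finset.card_le_card hsub).trans ((Finset.card_union_le _ _).trans ?_)
  have h1 := Finset.card_union_le ((Finset.Ico (2 ^ (n + 3)) (2 ^ (n + 4))).image (2 * ·))
    (Finset.Ico (2 ^ (n + 2)) (2 ^ (n + 3)))
  have h2 := Finset.card_image_le (s := Finset.Ico (2 ^ (n + 3)) (2 ^ (n + 4))) (f := (2 * ·))
  simp only [Nat.card_Ico, pow_succ] at h1 h2 ⊢
  omega

/-! ### Lower bound -/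

/-- The number of elements of `S` in the subtree of height `h` below `x`. -/
def subtreeCount (S : Finset ℕ) (x : ℕ) : ℕ → ℕ
  | 0 => (S ∩ {x}).card
  | h + 1 => (S ∩ {x}).card + subtreeCount S (2 * x) h + subtreeCount S (2 * x + 1) h

theorem subtreeCount_eq_sum (S : Finset ℕ) (x h : ℕ) :
    subtreeCount S x h =
      ∑ k ∈ Finset.range (h + 1), (S ∩ Finset.Ico (x * 2 ^ k) ((x + 1) * 2 ^ k)).card := by
  induction h generalizing x with
  | zero => simp [subtreeCount]
  | succ h ih =>
    rw [Finset.sum_range_succ', subtreeCount, ih, ih, add_assoc, ← Finset.sum_add_distrib,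
      add_comm]
    congr 1
    · refine Finset.sum_congr rfl fun k _ => ?_
      rw [← Finset.card_union_of_disjoint, ← Finset.inter_union_distrib_left,
        Finset.Ico_union_Ico_eq_Ico]
      · congr 3 <;> ring
      · gcongr; omega
      · gcongr; omega
      · refine Finset.disjoint_left.2 fun a ha hb => ?_
        simp only [Finset.mem_inter, Finset.mem_Ico] at ha hb
        omega
    · simp

theorem subtreeCount_one_le_card (S : Finset ℕ) (n : ℕ) : subtreeCount S 1 n ≤ S.card := by
  have key : ∀ m, ∑ k ∈ Finset.range m, (S ∩ Finset.Ico (1 * 2 ^ k) ((1 + 1) * 2 ^ k)).card =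
      (S ∩ Finset.Ico 1 (2 ^ m)).card := by
    intro m
    induction m with
    | zero => simp
    | succ m ih =>
      rw [Finset.sum_range_succ, ih, ← Finset.card_union_of_disjoint,
        ← Finset.inter_union_distrib_left, one_mul, Finset.Ico_union_Ico_eq_Ico]
      · congr 3; ring
      · exact Nat.one_le_two_pow
      · omega
      · refine Finset.disjoint_left.2 fun a ha hb => ?_
        simp only [Finset.mem_inter, Finset.mem_Ico] at ha hb
        omega
  rw [subtreeCount_eq_sum, key]
  exact Finset.card_le_card Finset.inter_subset_left

/-- `x` has a child outside `S` whose only neighbour in `S` is `x`. -/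
def HasPrivateChild (S : Finset ℕ) (M x : ℕ) : Prop :=
  ∃ y, y / 2 = x ∧ y < M ∧ y ∉ S ∧ ∀ w ∈ S, SibNbr w y ↔ w = x

/-- Some child of `x` lies in `S`. -/
def CoveredBelow (S : Finset ℕ) (x : ℕ) : Prop := 2 * x ∈ S ∨ 2 * x + 1 ∈ S

/-- Some other vertex outside `S` sees in `S` exactly the children of `x`. -/
def ConfusedBelow (S : Finset ℕ) (M x : ℕ) : Prop :=
  ∃ v, 1 ≤ v ∧ v < M ∧ v ∉ S ∧ v ≠ x ∧ ∀ w ∈ S, SibNbr w v ↔ w / 2 = x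

/-- The bound `4 * 2 ^ h + e` with an offset `e` depending on `h` modulo `4`. -/
def sibBound (e₀ e₁ e₂ e₃ : ℤ) (h : ℕ) : ℤ :=
  4 * 2 ^ h + if h % 4 = 0 then e₀ else if h % 4 = 1 then e₁ else if h % 4 = 2 then e₂ else e₃

/-- Lower bounds for the number of elements of `S` below `x`, according to how `S` looks
around `x`. -/
structure SubtreeBounds (S : Finset ℕ) (M x h : ℕ) : Prop where
  mem : x ∈ S → sibBound 1 2 (-1) 3 h ≤ 5 * (subtreeCount S x h : ℤ)
  priv : x ∈ S → HasPrivateChild S M x → sibBound 1 2 4 8 h ≤ 5 * (subtreeCount S x h : ℤ)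
  free : x ∉ S → CoveredBelow S x → ¬ ConfusedBelow S M x →
    sibBound 1 2 (-1) (-2) h ≤ 5 * (subtreeCount S x h : ℤ)
  confused : x ∉ S → CoveredBelow S x → ConfusedBelow S M x →
    sibBound 1 (-3) (-1) 3 h ≤ 5 * (subtreeCount S x h : ℤ)
  uncovered : x ∉ S → ¬ CoveredBelow S x →
    sibBound (-4) 2 4 (-2) h ≤ 5 * (subtreeCount S x h : ℤ)

section Local

variable {S : Finset ℕ} {M : ℕ}

/-- If only `p` can see two vertices `l`, `r` in `S`, they cannot both be uncovered. -/
theorem covered_of_parent_mem {p l r : ℕ} (hlr : l / 2 = p ∧ r / 2 = p ∧ l ≠ r)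
    (hloc : ∀ u v, 1 ≤ u → u < M → 1 ≤ v → v < M → u ∉ S → v ∉ S →
      (∀ w ∈ S, SibNbr w u ↔ SibNbr w v) → u = v)
    (hp : 1 ≤ p) (hl : l < M) (hr : r < M) (hlS : l ∉ S) (hrS : r ∉ S)
    (hcl : ¬ CoveredBelow S l) : CoveredBelow S r := by
  by_contra hcr
  unfold CoveredBelow at hcl hcr
  refine hlr.2.2 (hloc l r (by omega) hl (by omega) hr hlS hrS fun w hw => ?_)
  have h1 : w ≠ l := by rintro rfl; exact hlS hw
  have h2 : w ≠ r := by rintro rfl; exact hrS hw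
  have h3 : w ≠ 2 * l ∧ w ≠ 2 * l + 1 := by
    constructor <;> rintro rfl <;> tauto
  have h4 : w ≠ 2 * r ∧ w ≠ 2 * r + 1 := by
    constructor <;> rintro rfl <;> tauto
  unfold SibNbr
  omega

/-- A private child of `p` and its sibling are outside `S`, and the former is uncovered. -/
theorem HasPrivateChild.exists_children {p : ℕ} (hp : 1 ≤ p) (h : HasPrivateChild S M p) :
    ∃ y z, y / 2 = p ∧ z / 2 = p ∧ y ≠ z ∧ y ∉ S ∧ z ∉ S ∧ ¬ CoveredBelow S y := by
  obtain ⟨y, hy, -, hyS, h⟩ := h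
  unfold SibNbr at h
  refine ⟨y, 4 * p + 1 - y, hy, by omega, by omega, hyS, fun hz => ?_, ?_⟩
  · have := h _ hz
    omega
  · rintro (h' | h')
    · have := h _ h'
      omega
    · have := h _ h'
      omega

theorem not_confusedBelow_of_sees_children {x : ℕ}
    (hloc : ∀ u v, 1 ≤ u → u < M → 1 ≤ v → v < M → u ∉ S → v ∉ S →
      (∀ w ∈ S, SibNbr w u ↔ SibNbr w v) → u = v)
    (hx : 1 ≤ x) (hxM : x < M) (hxS : x ∉ S)
    (h : ∀ w ∈ S, SibNbr w x ↔ w / 2 = x) : ¬ ConfusedBelow S M x := by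
  rintro ⟨v, hv, hvM, hvS, hne, h'⟩
  exact hne (hloc v x hv hvM hx hxM hvS hxS fun w hw => (h' w hw).trans (h w hw).symm)

theorem coveredBelow_of_sees_children {x : ℕ}
    (hdom : ∀ v, 1 ≤ v → v < M → v ∉ S → ∃ u ∈ S, SibNbr u v)
    (hx : 1 ≤ x) (hxM : x < M) (hxS : x ∉ S)
    (h : ∀ w ∈ S, SibNbr w x ↔ w / 2 = x) : CoveredBelow S x := by
  obtain ⟨u, hu, hux⟩ := hdom x hx hxM hxS
  have := (h u hu).1 hux
  rcases (by omega : u = 2 * x ∨ u = 2 * x + 1) with rfl | rfl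
  · exact Or.inl hu
  · exact Or.inr hu

theorem sees_children_of_not_mem {p l r : ℕ} (hlr : l / 2 = p ∧ r / 2 = p ∧ l ≠ r)
    (hp : 1 ≤ p) (hpS : p ∉ S) (hlS : l ∉ S) (hrS : r ∉ S) :
    ∀ w ∈ S, SibNbr w l ↔ w / 2 = l := by
  intro w hw
  have h1 : w ≠ l := by rintro rfl; exact hlS hw
  have h2 : w ≠ r := by rintro rfl; exact hrS hw
  have h3 : w ≠ p := by rintro rfl; exact hpS hw
  unfold SibNbr
  omega

theorem not_confusedBelow_of_children_mem {p l r : ℕ} (hlr : l / 2 = p ∧ r / 2 = p ∧ l ≠ r)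
    (hp : 1 ≤ p) (hlS : l ∈ S) (hrS : r ∈ S) : ¬ ConfusedBelow S M p := by
  rintro ⟨v, hv, -, hvS, hne, h⟩
  have h1 := (h l hlS).2 hlr.1
  have h2 := (h r hrS).2 hlr.2.1
  have h3 : v ≠ l := by rintro rfl; exact hvS hlS
  have h4 : v ≠ r := by rintro rfl; exact hvS hrS
  unfold SibNbr at h1 h2
  omega

theorem confusedBelow_of_not_covered {p l r : ℕ} (hlr : l / 2 = p ∧ r / 2 = p ∧ l ≠ r)
    (hp : 1 ≤ p) (hr : r < M) (hpS : p ∉ S) (hrS : r ∉ S)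
    (hcr : ¬ CoveredBelow S r) : ConfusedBelow S M p := by
  refine ⟨r, by omega, hr, hrS, by omega, fun w hw => ?_⟩
  unfold CoveredBelow at hcr
  have h2 : w ≠ r := by rintro rfl; exact hrS hw
  have h3 : w ≠ p := by rintro rfl; exact hpS hw
  have h4 : w ≠ 2 * r ∧ w ≠ 2 * r + 1 := by
    constructor <;> rintro rfl <;> tauto
  unfold SibNbr
  omega

theorem hasPrivateChild_of_confusedBelow {p l r : ℕ} (hlr : l / 2 = p ∧ r / 2 = p ∧ l ≠ r)
    (hp : 1 ≤ p) (hlS : l ∈ S) (hrS : r ∉ S) (hcr : CoveredBelow S r)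
    (hconf : ConfusedBelow S M p) : HasPrivateChild S M l := by
  obtain ⟨v, hv, hvM, hvS, hne, h⟩ := hconf
  have hvl : v ≠ l := by rintro rfl; exact hvS hlS
  have h1 := (h l hlS).2 hlr.1
  have h2 : v ≠ r := by
    rintro rfl
    rcases hcr with h' | h'
    · have := h _ h'
      unfold SibNbr at this
      omega
    · have := h _ h'
      unfold SibNbr at this
      omega
  refine ⟨v, ?_, hvM, hvS, fun w hw => ?_⟩
  · unfold SibNbr at h1
    omega
  · rw [h w hw]
    have h3 : w ≠ r := by rintro rfl; exact hrS hw
    omega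

theorem subtreeBounds_zero {x : ℕ} (hS : ∀ y ∈ S, y < M) (hM : M ≤ 2 * x) :
    SubtreeBounds S M x 0 := by
  have hcov : ¬ CoveredBelow S x := by
    rintro (h | h)
    · have := hS _ h
      omega
    · have := hS _ h
      omega
  refine ⟨fun h => ?_, fun _ ⟨y, hy, hyM, _⟩ => ?_, fun _ h => absurd h hcov,
    fun _ h => absurd h hcov, fun h _ => ?_⟩
  · simp [sibBound, subtreeCount, h]
  · omega
  · simp [sibBound]

theorem sibBound_coveredBelow_le (h : ℕ) :
    sibBound 1 (-3) (-1) (-2) h ≤ sibBound 1 2 (-1) (-2) h ∧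
    sibBound 1 (-3) (-1) (-2) h ≤ sibBound 1 (-3) (-1) 3 h := by
  simp only [sibBound]
  split_ifs <;> omega

theorem sibBound_succ_le (h : ℕ) :
    sibBound 1 2 (-1) 3 (h + 1) ≤ 5 + 2 * sibBound 1 2 (-1) 3 h ∧
    sibBound 1 2 (-1) 3 (h + 1) ≤
      5 + sibBound 1 2 (-1) 3 h + sibBound 1 (-3) (-1) (-2) h ∧
    sibBound 1 2 (-1) 3 (h + 1) ≤ 5 + sibBound 1 2 (-1) 3 h + sibBound (-4) 2 4 (-2) h ∧
    sibBound 1 2 (-1) 3 (h + 1) ≤ 5 + 2 * sibBound 1 (-3) (-1) (-2) h ∧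
    sibBound 1 2 (-1) 3 (h + 1) ≤
      5 + sibBound (-4) 2 4 (-2) h + sibBound 1 (-3) (-1) (-2) h ∧
    sibBound 1 2 4 8 (h + 1) ≤ 5 + sibBound (-4) 2 4 (-2) h + sibBound 1 (-3) (-1) (-2) h ∧
    sibBound 1 2 (-1) (-2) (h + 1) ≤ 2 * sibBound 1 2 (-1) 3 h ∧
    sibBound 1 2 (-1) (-2) (h + 1) ≤
      sibBound 1 2 (-1) 3 h + sibBound 1 (-3) (-1) (-2) h ∧
    sibBound 1 (-3) (-1) 3 (h + 1) ≤ sibBound 1 2 4 8 h + sibBound 1 (-3) (-1) (-2) h ∧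
    sibBound 1 (-3) (-1) 3 (h + 1) ≤ sibBound 1 2 (-1) 3 h + sibBound (-4) 2 4 (-2) h ∧
    sibBound (-4) 2 4 (-2) (h + 1) ≤ 2 * sibBound 1 2 (-1) (-2) h := by
  simp only [sibBound, pow_succ]
  rcases (by omega : h % 4 = 0 ∧ (h + 1) % 4 = 1 ∨ h % 4 = 1 ∧ (h + 1) % 4 = 2 ∨
    h % 4 = 2 ∧ (h + 1) % 4 = 3 ∨ h % 4 = 3 ∧ (h + 1) % 4 = 0) with
    ⟨e, e'⟩ | ⟨e, e'⟩ | ⟨e, e'⟩ | ⟨e, e'⟩ <;>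
  · simp only [e, e']
    norm_num
    omega

theorem SubtreeBounds.covered {x h : ℕ} (hb : SubtreeBounds S M x h) (hx : x ∉ S)
    (hc : CoveredBelow S x) :
    sibBound 1 (-3) (-1) (-2) h ≤ 5 * (subtreeCount S x h : ℤ) := by
  by_cases hconf : ConfusedBelow S M x
  · exact (sibBound_coveredBelow_le h).2.trans (hb.confused hx hc hconf)
  · exact (sibBound_coveredBelow_le h).1.trans (hb.free hx hc hconf)

/-- The case of `subtreeBounds_succ` in which exactly one child of a vertex outside `S` is in
`S`. -/
theorem bounds_of_one_child_mem {p l r h : ℕ} (hlr : l / 2 = p ∧ r / 2 = p ∧ l ≠ r)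
    (hp : 1 ≤ p) (hr : r < M) (hpS : p ∉ S) (hlS : l ∈ S) (hrS : r ∉ S)
    (hbl : SubtreeBounds S M l h) (hbr : SubtreeBounds S M r h) :
    (¬ ConfusedBelow S M p → sibBound 1 2 (-1) (-2) (h + 1) ≤
      5 * (subtreeCount S l h : ℤ) + 5 * (subtreeCount S r h : ℤ)) ∧
    (ConfusedBelow S M p → sibBound 1 (-3) (-1) 3 (h + 1) ≤
      5 * (subtreeCount S l h : ℤ) + 5 * (subtreeCount S r h : ℤ)) := by
  have hbd := sibBound_succ_le h
  have hl := hbl.mem hlS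
  by_cases hcr : CoveredBelow S r
  · have hr' := hbr.covered hrS hcr
    refine ⟨fun _ => by linarith, fun hconf => ?_⟩
    have := hbl.priv hlS (hasPrivateChild_of_confusedBelow hlr hp hlS hrS hcr hconf)
    linarith
  · have hr' := hbr.uncovered hrS hcr
    refine ⟨fun hconf => ?_, fun _ => by linarith⟩
    exact absurd (confusedBelow_of_not_covered hlr hp hr hpS hrS hcr) hconf

theorem subtreeBounds_succ {p h : ℕ}
    (hdom : ∀ v, 1 ≤ v → v < M → v ∉ S → ∃ u ∈ S, SibNbr u v)
    (hloc : ∀ u v, 1 ≤ u → u < M → 1 ≤ v → v < M → u ∉ S → v ∉ S →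
      (∀ w ∈ S, SibNbr w u ↔ SibNbr w v) → u = v)
    (hp : 1 ≤ p) (hM : 2 * p + 1 < M)
    (hbl : SubtreeBounds S M (2 * p) h) (hbr : SubtreeBounds S M (2 * p + 1) h) :
    SubtreeBounds S M p (h + 1) := by
  have hlr : 2 * p / 2 = p ∧ (2 * p + 1) / 2 = p ∧ 2 * p ≠ 2 * p + 1 := by omega
  have hrl : (2 * p + 1) / 2 = p ∧ 2 * p / 2 = p ∧ 2 * p + 1 ≠ 2 * p := by omega
  have hl : 2 * p < M := by omega
  have hbd := sibBound_succ_le h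
  have hmem : p ∈ S → (subtreeCount S p (h + 1) : ℤ) =
      1 + subtreeCount S (2 * p) h + subtreeCount S (2 * p + 1) h := fun hpS => by
    simp [subtreeCount, hpS]
  have hnot : p ∉ S → (subtreeCount S p (h + 1) : ℤ) =
      subtreeCount S (2 * p) h + subtreeCount S (2 * p + 1) h := fun hpS => by
    simp [subtreeCount, hpS]
  have hcases : p ∉ S → CoveredBelow S p →
      (¬ ConfusedBelow S M p → sibBound 1 2 (-1) (-2) (h + 1) ≤
        5 * (subtreeCount S p (h + 1) : ℤ)) ∧
      (ConfusedBelow S M p → sibBound 1 (-3) (-1) 3 (h + 1) ≤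
        5 * (subtreeCount S p (h + 1) : ℤ)) := by
    intro hpS hcov
    rw [hnot hpS, mul_add]
    by_cases hlS : 2 * p ∈ S <;> by_cases hrS : 2 * p + 1 ∈ S
    · have h1 := hbl.mem hlS
      have h2 := hbr.mem hrS
      refine ⟨fun _ => by linarith, fun hconf => ?_⟩
      exact absurd hconf (not_confusedBelow_of_children_mem hlr hp hlS hrS)
    · exact bounds_of_one_child_mem hlr hp hM hpS hlS hrS hbl hbr
    · rw [add_comm (5 * (subtreeCount S (2 * p) h : ℤ))]
      exact bounds_of_one_child_mem hrl hp hl hpS hrS hlS hbr hbl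
    · exact absurd hcov (not_or.2 ⟨hlS, hrS⟩)
  refine ⟨fun hpS => ?_, fun hpS hpriv => ?_, fun hpS hcov => (hcases hpS hcov).1,
    fun hpS hcov => (hcases hpS hcov).2, fun hpS hcov => ?_⟩
  · rw [hmem hpS]
    by_cases hlS : 2 * p ∈ S <;> by_cases hrS : 2 * p + 1 ∈ S
    · have h1 := hbl.mem hlS
      have h2 := hbr.mem hrS
      linarith
    · have h1 := hbl.mem hlS
      by_cases hcr : CoveredBelow S (2 * p + 1)
      · have := hbr.covered hrS hcr
        linarith
      · have := hbr.uncovered hrS hcr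
        linarith
    · have h1 := hbr.mem hrS
      by_cases hcl : CoveredBelow S (2 * p)
      · have := hbl.covered hlS hcl
        linarith
      · have := hbl.uncovered hlS hcl
        linarith
    · by_cases hcl : CoveredBelow S (2 * p)
      · have h1 := hbl.covered hlS hcl
        by_cases hcr : CoveredBelow S (2 * p + 1)
        · have := hbr.covered hrS hcr
          linarith
        · have := hbr.uncovered hrS hcr
          linarith
      · have h1 := hbl.uncovered hlS hcl
        have := hbr.covered hrS (covered_of_parent_mem hlr hloc hp hl hM hlS hrS hcl)
        linarith
  · rw [hmem hpS]
    obtain ⟨y, z, hy, hz, hyz, hyS, hzS, hcy⟩ := hpriv.exists_children hp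
    have hcz := covered_of_parent_mem ⟨hy, hz, hyz⟩ hloc hp (by omega) (by omega) hyS hzS hcy
    rcases (by omega : y = 2 * p ∧ z = 2 * p + 1 ∨ y = 2 * p + 1 ∧ z = 2 * p) with
      ⟨rfl, rfl⟩ | ⟨rfl, rfl⟩
    · have h1 := hbl.uncovered hyS hcy
      have h2 := hbr.covered hzS hcz
      linarith
    · have h1 := hbr.uncovered hyS hcy
      have h2 := hbl.covered hzS hcz
      linarith
  · rw [hnot hpS]
    obtain ⟨hlS, hrS⟩ := not_or.1 hcov
    have hsl := sees_children_of_not_mem hlr hp hpS hlS hrS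
    have hsr := sees_children_of_not_mem hrl hp hpS hrS hlS
    have h1 := hbl.free hlS (coveredBelow_of_sees_children hdom (by omega) hl hlS hsl)
      (not_confusedBelow_of_sees_children hloc (by omega) hl hlS hsl)
    have h2 := hbr.free hrS (coveredBelow_of_sees_children hdom (by omega) hM hrS hsr)
      (not_confusedBelow_of_sees_children hloc (by omega) hM hrS hsr)
    linarith

theorem subtreeBounds (hS : ∀ y ∈ S, y < M)
    (hdom : ∀ v, 1 ≤ v → v < M → v ∉ S → ∃ u ∈ S, SibNbr u v)
    (hloc : ∀ u v, 1 ≤ u → u < M → 1 ≤ v → v < M → u ∉ S → v ∉ S →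
      (∀ w ∈ S, SibNbr w u ↔ SibNbr w v) → u = v) (h : ℕ) :
    ∀ x, 1 ≤ x → (x + 1) * 2 ^ h ≤ M → M ≤ 2 * x * 2 ^ h → SubtreeBounds S M x h := by
  induction h with
  | zero => exact fun x _ _ h2 => subtreeBounds_zero hS (by omega)
  | succ h ih =>
    intro x hx h1 h2
    have hpos : 1 ≤ 2 ^ h := Nat.one_le_two_pow
    rw [pow_succ] at h1 h2
    refine subtreeBounds_succ hdom hloc hx (by nlinarith) (ih _ (by omega) ?_ ?_)
      (ih _ (by omega) ?_ ?_) <;> nlinarith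

end Local

theorem sibBound_le_card {n : ℕ} {S : Finset ℕ}
    (h : IsLocDomSetOn (siblingTree n) (treeVerts n) S) :
    sibBound 1 2 (-1) (-2) n ≤ 5 * (S.card : ℤ) := by
  obtain ⟨hS, hdom, hloc⟩ := isLocDomSetOn_siblingTree_iff.1 h
  have hM : 1 < 2 ^ (n + 1) := Nat.one_lt_two_pow (by omega)
  have hb := subtreeBounds (fun y hy => (hS y hy).2) hdom hloc n 1 le_rfl
    (by rw [pow_succ]; omega) (by rw [pow_succ]; omega)
  have hcard : (subtreeCount S 1 n : ℤ) ≤ S.card := by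
    exact_mod_cast subtreeCount_one_le_card S n
  by_cases h1 : 1 ∈ S
  · have := hb.mem h1
    have : sibBound 1 2 (-1) (-2) n ≤ sibBound 1 2 (-1) 3 n := by
      simp only [sibBound]
      split_ifs <;> omega
    linarith
  · have hsee : ∀ w ∈ S, SibNbr w 1 ↔ w / 2 = 1 := by
      intro w hw
      have := hS w hw
      have : w ≠ 1 := by rintro rfl; exact h1 hw
      unfold SibNbr
      omega
    have := hb.free h1 (coveredBelow_of_sees_children hdom le_rfl hM h1 hsee)
      (not_confusedBelow_of_sees_children hloc le_rfl hM h1 hsee)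
    linarith

theorem card_sibOptSet_le (n : ℕ) :
    5 * ((sibOptSet n).card : ℤ) ≤ sibBound 1 2 (-1) (-2) n := by
  induction n using Nat.strong_induction_on with
  | _ n ih =>
    rcases Nat.lt_or_ge n 4 with hn | hn
    · interval_cases n <;> decide
    · obtain ⟨m, rfl⟩ := Nat.exists_eq_add_of_le' hn
      have h1 := ih m (by omega)
      have h2 : ((sibOptSet (m + 4)).card : ℤ) ≤ (sibOptSet m).card + 12 * 2 ^ m := by
        exact_mod_cast card_sibOptSet_add_four_le m
      have h3 : sibBound 1 2 (-1) (-2) (m + 4) = sibBound 1 2 (-1) (-2) m + 60 * 2 ^ m := by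
        simp only [sibBound, Nat.add_mod_right, pow_add]
        ring
      linarith

theorem five_mul_locDomNum_siblingTree (n : ℕ) :
    5 * (locDomNum (siblingTree n) (treeVerts n) : ℤ) = sibBound 1 2 (-1) (-2) n := by
  have hmem : (sibOptSet n).card ∈
      {k | ∃ S : Finset ℕ, IsLocDomSetOn (siblingTree n) (treeVerts n) S ∧ S.card = k} :=
    ⟨_, isLocDomSetOn_sibOptSet n, rfl⟩
  obtain ⟨S, hS, hcard⟩ := Nat.sInf_mem ⟨_, hmem⟩
  have h1 := sibBound_le_card hS
  have h2 := card_sibOptSet_le n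
  have h3 : (locDomNum (siblingTree n) (treeVerts n) : ℤ) ≤ (sibOptSet n).card := by
    exact_mod_cast Nat.sInf_le hmem
  rw [hcard] at h1
  unfold locDomNum at h3 ⊢
  omega

/-- The locating-domination number of the sibling tree `ST_n`, `n ≥ 1`. -/
theorem locDomNum_siblingTree (n : ℕ) (hn : 1 ≤ n) :
    (n % 4 = 0 → locDomNum (siblingTree n) (treeVerts n) = (2 ^ (n + 2) + 1) / 5) ∧
    (n % 4 = 1 → locDomNum (siblingTree n) (treeVerts n) = (2 ^ (n + 2) + 2) / 5) ∧
    (n % 4 = 2 → locDomNum (siblingTree n) (treeVerts n) = (2 ^ (n + 2) - 1) / 5) ∧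
    (n % 4 = 3 → locDomNum (siblingTree n) (treeVerts n) = (2 ^ (n + 2) - 2) / 5) := by
  have h := five_mul_locDomNum_siblingTree n
  have hpow : (2 : ℤ) ^ n = ((2 ^ n : ℕ) : ℤ) := by push_cast; rfl
  have hpos : 2 ≤ 2 ^ n := by simpa using Nat.pow_le_pow_right (n := 2) (by norm_num) hn
  simp only [sibBound, hpow] at h
  rw [pow_add]
  refine ⟨fun e => ?_, fun e => ?_, fun e => ?_, fun e => ?_⟩ <;>
  · simp only [e] at h
    norm_num at h
    omega
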